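/- Let q be a prime power, F the finite field with q elements, and n ≥ 1 an integer. Let (A_i)_{i≥1} be an infinite sequence of linear codes over F with strictly increasing lengths N_i, where each A_i ⊆ F^{N_i} is the linear code defined by requiring (A_i)_{R_{i,j}} = C_{i,j} for all j ∈ [N_i] (i.e., the restriction of A_i to each repair group R_{i,j} equals C_{i,j}), with the list of subsets (R_{i,j})_{j∈[N_i]} (each containing j) satisfying conditions (R1)–(R3) and each constituent C_{i,j} being a linear [|R_{i,j}|, |R_{i,j}|-1, 2] code over F. Then for any sequence (ω_i)_{i≥1} of nonnegative reals with liminf_i ω_i = ω, one has limsup_{i→∞} (1/N_i)·log_q( |A_i| / |A_i(ω_i)| ) ≤ R̂_0(ω,n). -/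

import Mathlib

open Filter Set

noncomputable section

/-- Minimum (Hamming) distance of a code. -/
def minDist {K : Type} [DecidableEq K] {ι : Type} [Fintype ι] (C : Set (ι → K)) : ℕ :=
  sInf {d : ℕ | ∃ c ∈ C, ∃ c' ∈ C, c ≠ c' ∧ hammingDist c c' = d}

/-- `R` is a repair group for coordinate `j` of the code `A`: it contains `j` and there
is a recovery function depending only on the coordinates in `R ∖ {j}` that recovers the
`j`-th entry of every codeword. -/
def IsRepairGroupFor {K : Type} {ι : Type} [DecidableEq ι] (A : Set (ι → K)) (j : ι)
    (R : Finset ι) : Prop :=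
  j ∈ R ∧ ∃ φ : (ι → K) → K,
    (∀ x y : ι → K, (∀ i ∈ R.erase j, x i = y i) → φ x = φ y) ∧
    ∀ c ∈ A, c j = φ c

/-- `λ_q(ω,n)`. -/
def lambdaQ (q : ℕ) (ω : ℝ) (n : ℕ) : ℝ :=
  ⨅ z : Set.Ioc (0:ℝ) 1,
    (-ω * Real.logb q (z : ℝ) - 1 / n +
      (1 / n) * Real.logb q ((1 + ((q:ℝ) - 1) * (z:ℝ)) ^ n + ((q:ℝ) - 1) * (1 - (z:ℝ)) ^ n))

/-- `R_0(ω,n) = (n-1)/n - λ_q(ω,n)`. -/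
def R0 (q : ℕ) (ω : ℝ) (n : ℕ) : ℝ := ((n:ℝ) - 1) / n - lambdaQ q ω n

/-- The inner minimum `min_ϑ Σ_{s∈[n]} π_s·R_0(ϑ_s,s)` over nonnegative vectors `ϑ`
with `Σ_s π_s·ϑ_s = ω`. -/
def innerMin (q n : ℕ) (ω : ℝ) (π : ℕ → ℝ) : ℝ :=
  sInf {t : ℝ | ∃ ϑ : ℕ → ℝ, (∀ s ∈ Finset.Icc 1 n, 0 ≤ ϑ s) ∧
    (∑ s ∈ Finset.Icc 1 n, π s * ϑ s) = ω ∧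
    t = ∑ s ∈ Finset.Icc 1 n, π s * R0 q (ϑ s) s}

/-- `R̄_0(ω,n,μ)`. -/
def Rbar0 (q n : ℕ) (ω μ : ℝ) : ℝ :=
  sSup {r : ℝ | ∃ π : ℕ → ℝ, (∀ s ∈ Finset.Icc 1 n, 0 ≤ π s) ∧
    (∑ s ∈ Finset.Icc 1 n, π s) = 1 ∧
    1 / μ ≤ (∑ s ∈ Finset.Icc 1 n, π s / (s : ℝ)) ∧
    r = innerMin q n ω π}

/-- `R̂_0(ω,n) = max_{ν ∈ [0,(n-1)/(n+1)]} [ ν + (1-ν)·R̄_0(ω/(1-ν), n, ((1-ν)/(1+ν))·n) ]`. -/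
def Rhat0 (q n : ℕ) (ω : ℝ) : ℝ :=
  sSup {r : ℝ | ∃ ν : ℝ, ν ∈ Set.Icc (0:ℝ) (((n:ℝ) - 1) / ((n:ℝ) + 1)) ∧
    r = ν + (1 - ν) * Rbar0 q n (ω / (1 - ν)) (((1 - ν) / (1 + ν)) * n)}

/-! ### Bounds on the rate functions -/

lemma le_one_add_pow_add (q : ℝ) (hq : 1 ≤ q) (n : ℕ) {z : ℝ} (hz : z ∈ Set.Ioc (0 : ℝ) 1) :
    q ≤ (1 + (q - 1) * z) ^ n + (q - 1) * (1 - z) ^ n := by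
  obtain ⟨hz0, hz1⟩ := hz
  have h1 := one_add_mul_le_pow (a := (q - 1) * z) (by nlinarith) n
  have h2 := one_add_mul_le_pow (a := -z) (by linarith) n
  have h3 := mul_le_mul_of_nonneg_left h2 (sub_nonneg.2 hq)
  rw [← sub_eq_add_neg] at h3
  nlinarith

/-- The function of `z` whose infimum over `(0, 1]` is `lambdaQ q ω n`. -/
def lambdaFun (q : ℕ) (ω : ℝ) (n : ℕ) (z : ℝ) : ℝ :=
  -ω * Real.logb q z - 1 / n +
    (1 / n) * Real.logb q ((1 + ((q : ℝ) - 1) * z) ^ n + ((q : ℝ) - 1) * (1 - z) ^ n)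

lemma lambdaFun_nonneg {q : ℕ} (hq : 2 ≤ q) {ω : ℝ} (hω : 0 ≤ ω) (n : ℕ) {z : ℝ}
    (hz : z ∈ Set.Ioc (0 : ℝ) 1) : 0 ≤ lambdaFun q ω n z := by
  have hq' : (1 : ℝ) < q := by exact_mod_cast hq
  have h1 : Real.logb q z ≤ 0 := Real.logb_nonpos hq' hz.1.le hz.2
  have h2 : 1 ≤ Real.logb q ((1 + ((q : ℝ) - 1) * z) ^ n + ((q : ℝ) - 1) * (1 - z) ^ n) := by
    have h := Real.logb_le_logb_of_le hq' (by linarith) (le_one_add_pow_add q hq'.le n hz)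
    rwa [Real.logb_self_eq_one hq'] at h
  have h3 : (0 : ℝ) ≤ 1 / n := by positivity
  unfold lambdaFun
  nlinarith

lemma bddBelow_lambdaFun {q : ℕ} (hq : 2 ≤ q) {ω : ℝ} (hω : 0 ≤ ω) (n : ℕ) :
    BddBelow (Set.range fun z : Set.Ioc (0 : ℝ) 1 => lambdaFun q ω n z) :=
  ⟨0, by rintro _ ⟨z, rfl⟩; exact lambdaFun_nonneg hq hω n z.2⟩

lemma lambdaQ_le {q : ℕ} (hq : 2 ≤ q) {ω : ℝ} (hω : 0 ≤ ω) (n : ℕ) {z : ℝ}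
    (hz : z ∈ Set.Ioc (0 : ℝ) 1) : lambdaQ q ω n ≤ lambdaFun q ω n z :=
  ciInf_le (bddBelow_lambdaFun hq hω n) ⟨z, hz⟩

lemma lambdaQ_nonneg {q : ℕ} (hq : 2 ≤ q) {ω : ℝ} (hω : 0 ≤ ω) (n : ℕ) : 0 ≤ lambdaQ q ω n :=
  Real.iInf_nonneg fun z => lambdaFun_nonneg hq hω n z.2

lemma R0_nonneg {q : ℕ} (hq : 2 ≤ q) {ω : ℝ} (hω : 0 ≤ ω) {n : ℕ} (hn : 1 ≤ n) :
    0 ≤ R0 q ω n := by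
  have hq' : (1 : ℝ) < q := by exact_mod_cast hq
  have hn' : (n : ℝ) ≠ 0 := by positivity
  have h := lambdaQ_le hq hω n (z := 1) ⟨one_pos, le_rfl⟩
  have h2 : lambdaFun q ω n 1 = ((n : ℝ) - 1) / n := by
    have h3 : Real.logb q ((q : ℝ) ^ n) = n := by
      rw [Real.logb_pow, Real.logb_self_eq_one hq', mul_one]
    simp only [lambdaFun, Real.logb_one, sub_self, mul_one, add_sub_cancel,
      zero_pow (Nat.one_le_iff_ne_zero.1 hn), mul_zero, add_zero, h3]
    field_simp
    ring
  unfold R0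
  linarith

lemma R0_le_one {q : ℕ} (hq : 2 ≤ q) {ω : ℝ} (hω : 0 ≤ ω) (n : ℕ) : R0 q ω n ≤ 1 := by
  have h := lambdaQ_nonneg hq hω n
  have h2 : ((n : ℝ) - 1) / n ≤ 1 := div_le_one_of_le₀ (by linarith) (by positivity)
  unfold R0
  linarith

lemma innerMin_le_one {q : ℕ} (hq : 2 ≤ q) (n : ℕ) {ω : ℝ} (hω : 0 ≤ ω) {π : ℕ → ℝ}
    (hπ : ∀ s ∈ Finset.Icc 1 n, 0 ≤ π s) (hπ1 : ∑ s ∈ Finset.Icc 1 n, π s = 1) :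
    innerMin q n ω π ≤ 1 := by
  refine csInf_le_of_le ⟨0, ?_⟩ ⟨fun _ => ω, fun _ _ => hω, ?_, rfl⟩ ?_
  · rintro t ⟨ϑ, hϑ, -, rfl⟩
    exact Finset.sum_nonneg fun s hs =>
      mul_nonneg (hπ s hs) (R0_nonneg hq (hϑ s hs) (Finset.mem_Icc.1 hs).1)
  · rw [← Finset.sum_mul, hπ1, one_mul]
  · rw [← hπ1]
    exact Finset.sum_le_sum fun s hs =>
      mul_le_of_le_one_right (hπ s hs) (R0_le_one hq hω s)

lemma Rbar0_le_one {q : ℕ} (hq : 2 ≤ q) (n : ℕ) {ω : ℝ} (hω : 0 ≤ ω) (μ : ℝ) :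
    Rbar0 q n ω μ ≤ 1 := by
  refine Real.sSup_le ?_ zero_le_one
  rintro r ⟨π, hπ, hπ1, -, rfl⟩
  exact innerMin_le_one hq n hω hπ hπ1

lemma innerMin_le_Rbar0 {q : ℕ} (hq : 2 ≤ q) (n : ℕ) {ω : ℝ} (hω : 0 ≤ ω) {μ : ℝ} {π : ℕ → ℝ}
    (hπ : ∀ s ∈ Finset.Icc 1 n, 0 ≤ π s) (hπ1 : ∑ s ∈ Finset.Icc 1 n, π s = 1)
    (hμ : 1 / μ ≤ ∑ s ∈ Finset.Icc 1 n, π s / (s : ℝ)) :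
    innerMin q n ω π ≤ Rbar0 q n ω μ := by
  refine le_csSup ⟨1, ?_⟩ ⟨π, hπ, hπ1, hμ, rfl⟩
  rintro r ⟨π', hπ', hπ1', -, rfl⟩
  exact innerMin_le_one hq n hω hπ' hπ1'

lemma le_Rhat0 {q : ℕ} (hq : 2 ≤ q) (n : ℕ) {ω : ℝ} (hω : 0 ≤ ω) {ν : ℝ}
    (hν : ν ∈ Set.Icc (0 : ℝ) (((n : ℝ) - 1) / ((n : ℝ) + 1))) :
    ν + (1 - ν) * Rbar0 q n (ω / (1 - ν)) (((1 - ν) / (1 + ν)) * n) ≤ Rhat0 q n ω := by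
  refine le_csSup ⟨1, ?_⟩ ⟨ν, hν, rfl⟩
  rintro r ⟨ν', ⟨-, hν'⟩, rfl⟩
  have h1 : ν' < 1 := hν'.trans_lt ((div_lt_one (by positivity)).2 (by linarith))
  have h2 := Rbar0_le_one hq n (div_nonneg hω (sub_pos.2 h1).le) (((1 - ν') / (1 + ν')) * n)
  nlinarith

/-- The parity-code weight enumerator of length `s`, evaluated at `z`. -/
def parityEnum (q s : ℕ) (z : ℝ) : ℝ :=
  ((1 + ((q : ℝ) - 1) * z) ^ s + ((q : ℝ) - 1) * (1 - z) ^ s) / q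

lemma logb_parityEnum {q : ℕ} (hq : 2 ≤ q) {s : ℕ} (hs : 1 ≤ s) (ϑ : ℝ) {z : ℝ}
    (hz : z ∈ Set.Ioc (0 : ℝ) 1) :
    Real.logb q (parityEnum q s z) = s * (lambdaFun q ϑ s z + ϑ * Real.logb q z) := by
  have hq' : (1 : ℝ) < q := by exact_mod_cast hq
  have hs' : (s : ℝ) ≠ 0 := by positivity
  have h := le_one_add_pow_add q hq'.le s hz
  rw [parityEnum, Real.logb_div (by linarith) (by linarith), Real.logb_self_eq_one hq', lambdaFun]
  field_simp
  ring

/-- A code whose blocks have lengths `s g` and whose enumerator is evaluated at `z` witnesses a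
lower bound on `Rhat0`. -/
lemma rate_le_Rhat0 {q : ℕ} (hq : 2 ≤ q) {n : ℕ} {ω : ℝ} (hω : 0 ≤ ω) {κ : Type*}
    (G : Finset κ) (s : κ → ℕ) (hs : ∀ g ∈ G, s g ∈ Finset.Icc 1 n) {N : ℝ} (hN : 0 < N)
    (hsum : ∑ g ∈ G, (s g : ℝ) ≤ N) (hcover : 2 * N - ∑ g ∈ G, (s g : ℝ) ≤ n * G.card)
    {z : ℝ} (hz : z ∈ Set.Ioc (0 : ℝ) 1) :
    N - G.card - (∑ g ∈ G, Real.logb q (parityEnum q (s g) z) - ω * N * Real.logb q z)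
      ≤ N * Rhat0 q n ω := by
  set S : ℝ := ∑ g ∈ G, (s g : ℝ) with hS
  have hGS : (G.card : ℝ) ≤ S := by
    rw [hS, Finset.card_eq_sum_ones, Nat.cast_sum]
    exact Finset.sum_le_sum fun g hg => by exact_mod_cast (Finset.mem_Icc.1 (hs g hg)).1
  have hn0 : (0 : ℝ) ≤ n := by positivity
  have hnG : (0 : ℝ) < n * G.card := by linarith
  have hG0 : (0 : ℝ) < G.card := pos_of_mul_pos_right hnG hn0
  have hn : (0 : ℝ) < n := pos_of_mul_pos_left hnG hG0.le
  have hS0 : 0 < S := hG0.trans_le hGS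
  set ν : ℝ := (N - S) / N with hνdef
  have hν1 : 1 - ν = S / N := by rw [hνdef]; field_simp; ring
  have hν2 : 1 + ν = (2 * N - S) / N := by rw [hνdef]; field_simp; ring
  have hν : ν ∈ Set.Icc (0 : ℝ) (((n : ℝ) - 1) / ((n : ℝ) + 1)) := by
    refine ⟨div_nonneg (by linarith) hN.le, ?_⟩
    rw [hνdef, div_le_div_iff₀ hN (by positivity)]
    nlinarith [mul_le_mul_of_nonneg_left hGS hn0]
  set π : ℕ → ℝ := fun t => ∑ g ∈ G with s g = t, (s g : ℝ) / S with hπdef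
  have hπ : ∀ t ∈ Finset.Icc 1 n, 0 ≤ π t := fun t _ =>
    Finset.sum_nonneg fun g _ => by positivity
  have hfib : ∀ φ : ℕ → ℝ,
      ∑ t ∈ Finset.Icc 1 n, π t * φ t = ∑ g ∈ G, (s g : ℝ) / S * φ (s g) := by
    intro φ
    rw [← Finset.sum_fiberwise_of_maps_to hs]
    refine Finset.sum_congr rfl fun t _ => ?_
    rw [hπdef, Finset.sum_mul]
    exact Finset.sum_congr rfl fun g hg => by rw [(Finset.mem_filter.1 hg).2]
  have hπ1 : ∑ t ∈ Finset.Icc 1 n, π t = 1 := by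
    have h := hfib fun _ => 1
    simp only [mul_one] at h
    rw [h, ← Finset.sum_div, ← hS, div_self hS0.ne']
  have hπinv : ∑ t ∈ Finset.Icc 1 n, π t / (t : ℝ) = G.card / S := by
    simp only [div_eq_mul_inv (π _)]
    rw [hfib fun t => (t : ℝ)⁻¹, Finset.card_eq_sum_ones, Nat.cast_sum, Finset.sum_div]
    refine Finset.sum_congr rfl fun g hg => ?_
    have : (s g : ℝ) ≠ 0 := by
      exact_mod_cast (Nat.one_le_iff_ne_zero.1 (Finset.mem_Icc.1 (hs g hg)).1)
    push_cast
    field_simp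
  have hω' : 0 ≤ ω / (1 - ν) := by rw [hν1]; positivity
  have hin : (N - G.card - (∑ g ∈ G, Real.logb q (parityEnum q (s g) z) - ω * N * Real.logb q z)
      - (N - S)) / S ≤ innerMin q n (ω / (1 - ν)) π := by
    refine le_csInf ⟨_, fun _ => ω / (1 - ν), fun _ _ => hω', ?_, rfl⟩ ?_
    · rw [← Finset.sum_mul, hπ1, one_mul]
    rintro _ ⟨ϑ, hϑ, hϑω, rfl⟩
    have hstep : ∑ t ∈ Finset.Icc 1 n, π t * (((t : ℝ) - 1) / t - lambdaFun q (ϑ t) t z)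
        ≤ ∑ t ∈ Finset.Icc 1 n, π t * R0 q (ϑ t) t := by
      refine Finset.sum_le_sum fun t ht => mul_le_mul_of_nonneg_left ?_ (hπ t ht)
      exact sub_le_sub_left (lambdaQ_le hq (hϑ t ht) t hz) _
    refine le_trans (le_of_eq ?_) hstep
    have hterm : ∀ t ∈ Finset.Icc 1 n, π t * (((t : ℝ) - 1) / t - lambdaFun q (ϑ t) t z)
        = π t - π t / t - π t * (Real.logb q (parityEnum q t z) / t)
          + π t * ϑ t * Real.logb q z := by
      intro t ht
      have ht1 := (Finset.mem_Icc.1 ht).1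
      have : (t : ℝ) ≠ 0 := by positivity
      rw [logb_parityEnum hq ht1 (ϑ t) hz]
      field_simp
      ring
    rw [Finset.sum_congr rfl hterm, Finset.sum_add_distrib, Finset.sum_sub_distrib,
      Finset.sum_sub_distrib, hπ1, hπinv, ← Finset.sum_mul, hϑω,
      hfib fun t => Real.logb q (parityEnum q t z) / t, hν1]
    have hlog : ∑ g ∈ G, (s g : ℝ) / S * (Real.logb q (parityEnum q (s g) z) / s g)
        = (∑ g ∈ G, Real.logb q (parityEnum q (s g) z)) / S := by
      rw [Finset.sum_div]
      refine Finset.sum_congr rfl fun g hg => ?_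
      have : (s g : ℝ) ≠ 0 := by
        exact_mod_cast (Nat.one_le_iff_ne_zero.1 (Finset.mem_Icc.1 (hs g hg)).1)
      field_simp
    rw [hlog]
    field_simp
    ring
  have hbar := innerMin_le_Rbar0 hq n hω' (μ := ((1 - ν) / (1 + ν)) * n) hπ hπ1 (by
    rw [hπinv, hν1, hν2]
    have h2 : 0 < 2 * N - S := by linarith
    rw [div_div_div_cancel_right₀ hN.ne', one_div, mul_comm, mul_div_assoc', inv_div,
      div_le_div_iff₀ (by positivity) hS0]
    nlinarith)
  have hhat := le_Rhat0 hq n hω hν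
  have h := (div_le_iff₀ hS0).1 (hin.trans hbar)
  have hfin := mul_le_mul_of_nonneg_left hhat hN.le
  have hNν : N * ν = N - S := by rw [hνdef]; field_simp
  have hNν1 : N * (1 - ν) = S := by rw [hν1]; field_simp
  rw [mul_add, ← mul_assoc, hNν, hNν1] at hfin
  linarith

/-! ### Weight enumerators of parity codes -/

section ParityWords

variable {K : Type*} [Field K] [DecidableEq K] {ι : Type*} [Fintype ι] [DecidableEq ι]

lemma hammingNorm_le_card_of_support {S : Finset ι} {x : ι → K} (hx : ∀ t, t ∉ S → x t = 0) :
    hammingNorm x ≤ S.card := by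
  refine Finset.card_le_card fun t ht => ?_
  by_contra h
  exact (Finset.mem_filter.1 ht).2 (hx t h)

lemma hammingNorm_update {x : ι → K} {t : ι} (hx : x t = 0) (y : K) :
    hammingNorm (Function.update x t y) = hammingNorm x + if y = 0 then 0 else 1 := by
  split_ifs with hy
  · rw [hy, ← hx, Function.update_eq_self, add_zero]
  · unfold hammingNorm
    rw [← Finset.card_insert_of_notMem (a := t) (by simp [hx])]
    congr 1
    ext u
    by_cases hu : u = t
    · subst hu; simp [hy]
    · simp [hu]

variable [Fintype K]

/-- The words supported on `S` whose inner product with `a` over `S` is `c`. -/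
def parityWords (a : ι → K) (S : Finset ι) (c : K) : Finset (ι → K) :=
  Finset.univ.filter fun x => (∀ t, t ∉ S → x t = 0) ∧ ∑ t ∈ S, a t * x t = c

lemma mem_parityWords {a : ι → K} {S : Finset ι} {c : K} {x : ι → K} :
    x ∈ parityWords a S c ↔ (∀ t, t ∉ S → x t = 0) ∧ ∑ t ∈ S, a t * x t = c := by
  simp [parityWords]

lemma zero_mem_parityWords (a : ι → K) (S : Finset ι) : (0 : ι → K) ∈ parityWords a S 0 := by
  simp [mem_parityWords]

/-- Extending the support by one coordinate. -/
lemma sum_parityWords_insert (a : ι → K) {S : Finset ι} {t : ι} (ht : t ∉ S) (c : K) (z : ℝ) :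
    ∑ x ∈ parityWords a (insert t S) c, z ^ hammingNorm x
      = ∑ y : K, z ^ (if y = 0 then 0 else 1) *
          ∑ x ∈ parityWords a S (c - a t * y), z ^ hammingNorm x := by
  simp only [Finset.mul_sum]
  rw [Finset.sum_sigma']
  have hsum : ∀ (x : ι → K) (y : K),
      ∑ u ∈ S, a u * Function.update x t y u = ∑ u ∈ S, a u * x u := fun x y =>
    Finset.sum_congr rfl fun u hu => by
      rw [Function.update_of_ne (ne_of_mem_of_not_mem hu ht)]
  refine Finset.sum_bij' (fun x _ => ⟨x t, Function.update x t 0⟩)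
    (fun p _ => Function.update p.2 t p.1) ?_ ?_ ?_ ?_ ?_
  · intro x hx
    obtain ⟨h1, h2⟩ := mem_parityWords.1 hx
    rw [Finset.sum_insert ht] at h2
    refine Finset.mem_sigma.2 ⟨Finset.mem_univ _, mem_parityWords.2 ⟨fun u hu => ?_, ?_⟩⟩
    · by_cases hut : u = t
      · simp [hut]
      · simpa [hut] using h1 u (by simp [hu, hut])
    · rw [hsum, ← h2]; ring
  · rintro ⟨y, x⟩ hx
    obtain ⟨h1, h2⟩ := mem_parityWords.1 (Finset.mem_sigma.1 hx).2
    refine mem_parityWords.2 ⟨fun u hu => ?_, ?_⟩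
    · rw [Finset.mem_insert, not_or] at hu
      simpa [hu.1] using h1 u hu.2
    · rw [Finset.sum_insert ht, hsum, h2]; simp
  · intro x _
    simp
  · rintro ⟨y, x⟩ hx
    have h1 := (mem_parityWords.1 (Finset.mem_sigma.1 hx).2).1 t ht
    simp only [Function.update_self, Function.update_idem]
    rw [← h1, Function.update_eq_self]
  · intro x _
    have h := hammingNorm_update (x := Function.update x t 0) (t := t) (by simp) (x t)
    rw [Function.update_idem, Function.update_eq_self] at h
    rw [h, pow_add, mul_comm]

lemma sum_parityWords {q : ℕ} (hq : Fintype.card K = q) (a : ι → K) (S : Finset ι)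
    (ha : ∀ t ∈ S, a t ≠ 0) (c : K) (z : ℝ) :
    ∑ x ∈ parityWords a S c, z ^ hammingNorm x
      = ((1 + ((q : ℝ) - 1) * z) ^ S.card
          + (if c = 0 then (q : ℝ) - 1 else -1) * (1 - z) ^ S.card) / q := by
  have hq0 : (q : ℝ) ≠ 0 := by
    rw [← hq]; exact_mod_cast Fintype.card_ne_zero
  obtain ⟨e, he⟩ : ∃ e : K → ℝ, ∀ c, e c = if c = 0 then (q : ℝ) - 1 else -1 := ⟨_, fun _ => rfl⟩
  have htot : ∑ c : K, e c = 0 := by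
    have h : ∀ c : K, e c = (if c = 0 then (q : ℝ) else 0) - 1 := by
      intro c; rw [he]; split_ifs <;> ring
    simp [h, Finset.sum_sub_distrib, hq]
  rw [← he]
  induction S using Finset.induction_on generalizing c with
  | empty =>
    by_cases hc : c = 0
    · have : parityWords a ∅ c = {0} := by
        ext x; simp [mem_parityWords, hc, funext_iff]
      rw [this, he]
      simp [hc, hq0]
    · have : parityWords a ∅ c = ∅ := by
        ext x; simp [mem_parityWords, Ne.symm hc]
      rw [this, he]
      simp [hc]
  | insert t S ht ih =>
    have ha' : ∀ u ∈ S, a u ≠ 0 := fun u hu => ha u (Finset.mem_insert_of_mem hu)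
    have hat : a t ≠ 0 := ha t (Finset.mem_insert_self t S)
    rw [sum_parityWords_insert a ht]
    simp only [ih ha']
    have hsplit : ∀ y : K, z ^ (if y = 0 then 0 else 1) = z + if y = 0 then 1 - z else 0 := by
      intro y; split_ifs <;> simp
    have hbij : ∑ y : K, e (c - a t * y) = 0 := by
      rw [← htot]
      refine Fintype.sum_bijective (fun y => c - a t * y) ?_ _ _ fun _ => rfl
      refine Finite.injective_iff_bijective.1 fun y y' h => ?_
      exact mul_left_cancel₀ hat (sub_right_injective h)
    simp only [hsplit, add_mul, Finset.sum_add_distrib, ← Finset.mul_sum, ite_mul, zero_mul,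
      Finset.sum_ite_eq', Finset.mem_univ, if_true, mul_zero, sub_zero,
      Finset.card_insert_of_notMem ht]
    rw [← Finset.sum_div, Finset.sum_add_distrib, ← Finset.sum_mul, hbij, Finset.sum_const,
      Finset.card_univ, hq]
    simp only [nsmul_eq_mul]
    field_simp
    ring

lemma sum_parityWords_zero {q : ℕ} (hq : Fintype.card K = q) (a : ι → K) (S : Finset ι)
    (ha : ∀ t ∈ S, a t ≠ 0) (z : ℝ) :
    ∑ x ∈ parityWords a S 0, z ^ hammingNorm x = parityEnum q S.card z := by
  rw [sum_parityWords hq a S ha, if_pos rfl, parityEnum]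

lemma card_parityWords_le {q : ℕ} (hq : Fintype.card K = q) (a : ι → K) (S : Finset ι) (c : K) :
    (parityWords a S c).card ≤ q ^ S.card := by
  have h : (parityWords a S c).card ≤ (Finset.univ : Finset (S → K)).card := by
    refine Finset.card_le_card_of_injOn (fun x t => x t)
      (fun _ _ => Finset.mem_coe.2 (Finset.mem_univ _)) ?_
    intro x hx y hy h
    funext t
    by_cases ht : t ∈ S
    · exact congr_fun h ⟨t, ht⟩
    · rw [(mem_parityWords.1 hx).1 t ht, (mem_parityWords.1 hy).1 t ht]
  simpa [hq] using h

end ParityWords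

/-! ### A large-deviation lower bound for products of enumerators -/

section Tilting

open Polynomial

/-- The enumerator of a weight function `T` on a finite set `S`. -/
def weightPoly {α : Type*} (S : Finset α) (T : α → ℕ) : ℝ[X] := ∑ f ∈ S, X ^ T f

/-- Mean of the weight under the distribution proportional to `coeff w * z ^ w`. -/
def tiltMean (P : ℝ[X]) (z : ℝ) : ℝ := (X * derivative P).eval z / P.eval z

/-- Variance of the weight under the distribution proportional to `coeff w * z ^ w`. -/
def tiltVar (P : ℝ[X]) (z : ℝ) : ℝ :=
  (X * derivative (X * derivative P)).eval z / P.eval z - tiltMean P z ^ 2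

section WeightPoly

variable {α : Type*} (S : Finset α) (T : α → ℕ) (z : ℝ)

lemma eval_weightPoly : (weightPoly S T).eval z = ∑ f ∈ S, z ^ T f := by
  simp [weightPoly, eval_finsetSum]

lemma X_mul_derivative_X_pow (k : ℕ) : (X : ℝ[X]) * derivative (X ^ k) = C (k : ℝ) * X ^ k := by
  rcases k with _ | k
  · simp
  · rw [derivative_X_pow, Nat.add_sub_cancel, pow_succ]; ring

lemma X_mul_derivative_weightPoly :
    X * derivative (weightPoly S T) = ∑ f ∈ S, C (T f : ℝ) * X ^ T f := by
  simp only [weightPoly, derivative_sum, Finset.mul_sum, X_mul_derivative_X_pow]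

lemma eval_X_mul_derivative_weightPoly :
    (X * derivative (weightPoly S T)).eval z = ∑ f ∈ S, (T f : ℝ) * z ^ T f := by
  simp [X_mul_derivative_weightPoly, eval_finsetSum]

lemma eval_X_mul_derivative_twice_weightPoly :
    (X * derivative (X * derivative (weightPoly S T))).eval z
      = ∑ f ∈ S, (T f : ℝ) ^ 2 * z ^ T f := by
  have h : X * derivative (X * derivative (weightPoly S T))
      = ∑ f ∈ S, C ((T f : ℝ) ^ 2) * X ^ T f := by
    rw [X_mul_derivative_weightPoly, derivative_sum, Finset.mul_sum]
    refine Finset.sum_congr rfl fun f _ => ?_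
    rw [derivative_C_mul, mul_left_comm, X_mul_derivative_X_pow, ← mul_assoc, ← C_mul, sq]
  rw [h]
  simp [eval_finsetSum]

variable {S T z}

lemma one_le_eval_weightPoly (hz : 0 ≤ z) (h0 : ∃ f ∈ S, T f = 0) :
    1 ≤ (weightPoly S T).eval z := by
  obtain ⟨f, hf, hf0⟩ := h0
  rw [eval_weightPoly]
  calc (1 : ℝ) = z ^ T f := by rw [hf0, pow_zero]
    _ ≤ _ := Finset.single_le_sum (f := fun f => z ^ T f) (fun g _ => by positivity) hf

lemma tiltVar_weightPoly_le {n : ℕ} (hz : 0 ≤ z) (h0 : ∃ f ∈ S, T f = 0)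
    (hT : ∀ f ∈ S, T f ≤ n) : tiltVar (weightPoly S T) z ≤ (n : ℝ) ^ 2 := by
  have h1 := one_le_eval_weightPoly hz h0
  have h2 : (X * derivative (X * derivative (weightPoly S T))).eval z / (weightPoly S T).eval z
      ≤ (n : ℝ) ^ 2 := by
    rw [div_le_iff₀ (by linarith), eval_X_mul_derivative_twice_weightPoly, eval_weightPoly,
      Finset.mul_sum]
    refine Finset.sum_le_sum fun f hf => ?_
    have : (T f : ℝ) ≤ n := by exact_mod_cast hT f hf
    gcongr
  unfold tiltVar
  nlinarith [sq_nonneg (tiltMean (weightPoly S T) z)]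

lemma tiltMean_weightPoly_le {n Q : ℕ} (hz : 0 ≤ z) (hz1 : z ≤ 1) (h0 : ∃ f ∈ S, T f = 0)
    (hT : ∀ f ∈ S, T f ≤ n) (hQ : S.card ≤ Q) :
    tiltMean (weightPoly S T) z ≤ Q * (n * z) := by
  have h1 := one_le_eval_weightPoly hz h0
  have hnum : 0 ≤ (X * derivative (weightPoly S T)).eval z := by
    rw [eval_X_mul_derivative_weightPoly]
    exact Finset.sum_nonneg fun f _ => by positivity
  refine (div_le_self hnum h1).trans ?_
  rw [eval_X_mul_derivative_weightPoly]
  calc ∑ f ∈ S, (T f : ℝ) * z ^ T f ≤ ∑ _f ∈ S, (n : ℝ) * z := by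
        refine Finset.sum_le_sum fun f hf => ?_
        rcases Nat.eq_zero_or_pos (T f) with h | h
        · rw [h]; simp; positivity
        · have h3 : (T f : ℝ) ≤ n := by exact_mod_cast hT f hf
          have h4 : z ^ T f ≤ z := pow_le_of_le_one hz hz1 h.ne'
          gcongr
    _ = S.card * (n * z) := by simp
    _ ≤ Q * (n * z) := by gcongr

/-- Chebyshev's inequality for the tilted distribution. -/
lemma half_eval_le_sum_near_tiltMean (hz : 0 ≤ z) (hpos : 0 < (weightPoly S T).eval z) {Δ : ℝ}
    (hΔ : 0 < Δ) (hvar : 2 * tiltVar (weightPoly S T) z ≤ Δ ^ 2) :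
    (weightPoly S T).eval z / 2
      ≤ ∑ f ∈ S with |(T f : ℝ) - tiltMean (weightPoly S T) z| ≤ Δ, z ^ T f := by
  set E := tiltMean (weightPoly S T) z with hE
  set W := (weightPoly S T).eval z with hW
  have hmom : ∑ f ∈ S, ((T f : ℝ) - E) ^ 2 * z ^ T f = W * tiltVar (weightPoly S T) z := by
    have h1 : ∑ f ∈ S, (T f : ℝ) * z ^ T f = E * W := by
      rw [← eval_X_mul_derivative_weightPoly, hE, tiltMean, ← hW]; field_simp
    have h2 : ∑ f ∈ S, ((T f : ℝ) - E) ^ 2 * z ^ T f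
        = ∑ f ∈ S, (T f : ℝ) ^ 2 * z ^ T f - 2 * E * ∑ f ∈ S, (T f : ℝ) * z ^ T f
          + E ^ 2 * ∑ f ∈ S, z ^ T f := by
      rw [Finset.mul_sum, Finset.mul_sum, ← Finset.sum_sub_distrib, ← Finset.sum_add_distrib]
      exact Finset.sum_congr rfl fun f _ => by ring
    rw [h2, h1, ← eval_weightPoly, ← hW, ← eval_X_mul_derivative_twice_weightPoly, tiltVar, ← hW,
      ← hE]
    field_simp
    ring
  have hfar : Δ ^ 2 * ∑ f ∈ S with ¬ |(T f : ℝ) - E| ≤ Δ, z ^ T f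
      ≤ ∑ f ∈ S, ((T f : ℝ) - E) ^ 2 * z ^ T f := by
    rw [Finset.mul_sum]
    refine (Finset.sum_le_sum fun f hf => ?_).trans
      (Finset.sum_le_sum_of_subset_of_nonneg (Finset.filter_subset _ S) fun f _ _ => by positivity)
    have h : Δ ≤ |(T f : ℝ) - E| := (not_le.1 (Finset.mem_filter.1 hf).2).le
    rw [← sq_abs ((T f : ℝ) - E)]
    gcongr
  have hsplit := Finset.sum_filter_add_sum_filter_not S (fun f => |(T f : ℝ) - E| ≤ Δ)
    fun f => z ^ T f
  rw [← eval_weightPoly S T z, ← hW] at hsplit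
  have hle : Δ ^ 2 * ∑ f ∈ S with ¬ |(T f : ℝ) - E| ≤ Δ, z ^ T f ≤ Δ ^ 2 * (W / 2) := by
    rw [hmom] at hfar
    nlinarith
  have := le_of_mul_le_mul_left hle (by positivity)
  linarith

end WeightPoly

section Product

variable {κ : Type*} {G : Finset κ} {P : κ → ℝ[X]} {z : ℝ}

lemma tiltMean_mul {P Q : ℝ[X]} (hP : P.eval z ≠ 0) (hQ : Q.eval z ≠ 0) :
    tiltMean (P * Q) z = tiltMean P z + tiltMean Q z := by
  simp only [tiltMean, derivative_mul, eval_mul, eval_add]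
  field_simp

lemma tiltVar_mul {P Q : ℝ[X]} (hP : P.eval z ≠ 0) (hQ : Q.eval z ≠ 0) :
    tiltVar (P * Q) z = tiltVar P z + tiltVar Q z := by
  simp only [tiltVar, tiltMean, derivative_mul, derivative_add, derivative_X, eval_mul, eval_add,
    eval_X, eval_one]
  field_simp
  ring

lemma tiltMean_prod (h : ∀ g ∈ G, (P g).eval z ≠ 0) :
    tiltMean (∏ g ∈ G, P g) z = ∑ g ∈ G, tiltMean (P g) z := by
  classical
  induction G using Finset.induction_on with
  | empty => simp [tiltMean]
  | insert g G hg ih =>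
    have h' : ∀ k ∈ G, (P k).eval z ≠ 0 := fun k hk => h k (Finset.mem_insert_of_mem hk)
    rw [Finset.prod_insert hg, Finset.sum_insert hg, ← ih h',
      tiltMean_mul (h g (Finset.mem_insert_self g G))
        (by rw [eval_prod]; exact Finset.prod_ne_zero_iff.2 h')]

lemma tiltVar_prod (h : ∀ g ∈ G, (P g).eval z ≠ 0) :
    tiltVar (∏ g ∈ G, P g) z = ∑ g ∈ G, tiltVar (P g) z := by
  classical
  induction G using Finset.induction_on with
  | empty => simp [tiltVar, tiltMean]
  | insert g G hg ih =>
    have h' : ∀ k ∈ G, (P k).eval z ≠ 0 := fun k hk => h k (Finset.mem_insert_of_mem hk)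
    rw [Finset.prod_insert hg, Finset.sum_insert hg, ← ih h',
      tiltVar_mul (h g (Finset.mem_insert_self g G))
        (by rw [eval_prod]; exact Finset.prod_ne_zero_iff.2 h')]

end Product

/-- Either the mean weight of the untilted distribution is at most `w`, or some tilt has mean
exactly `w`. -/
lemma exists_tiltMean_eq {W : ℝ[X]} (hW : ∀ z : ℝ, 0 ≤ z → 1 ≤ W.eval z) {w : ℝ} (hw : 0 < w) :
    ∃ z ∈ Set.Ioc (0 : ℝ) 1, (z = 1 ∧ tiltMean W z ≤ w) ∨ tiltMean W z = w := by
  by_cases h1 : tiltMean W 1 ≤ w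
  · exact ⟨1, ⟨one_pos, le_rfl⟩, Or.inl ⟨rfl, h1⟩⟩
  have h0 : tiltMean W 0 = 0 := by simp [tiltMean]
  have hcont : ContinuousOn (tiltMean W) (Set.Icc 0 1) :=
    (Polynomial.continuousOn _).div (Polynomial.continuousOn _) fun z hz =>
      (zero_lt_one.trans_le (hW z hz.1)).ne'
  obtain ⟨z, hz, hzw⟩ := intermediate_value_Icc zero_le_one hcont
    ⟨h0.le.trans hw.le, (not_le.1 h1).le⟩
  refine ⟨z, ⟨lt_of_le_of_ne hz.1 ?_, hz.2⟩, Or.inr hzw⟩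
  rintro rfl
  exact hw.ne' (hzw.symm.trans h0)

/-- Lower bound for the number of points of weight at most `w + Δ` in a product set. -/
lemma exists_half_enum_le_card {κ α β : Type*} (G : Finset κ) (B : κ → Finset α) (t : α → ℕ)
    (S : Finset β) (T : β → ℕ) (hprod : weightPoly S T = ∏ g ∈ G, weightPoly (B g) t)
    {n Q : ℕ} (h0 : ∀ g ∈ G, ∃ y ∈ B g, t y = 0) (hn : ∀ g ∈ G, ∀ y ∈ B g, t y ≤ n)
    (hQ : ∀ g ∈ G, (B g).card ≤ Q) {w Δ : ℝ} (hw : 0 < w) (hΔ : 0 < Δ)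
    (hvar : 2 * (G.card * (n : ℝ) ^ 2) ≤ Δ ^ 2) :
    ∃ z ∈ Set.Ioc (0 : ℝ) 1, (z = 1 ∨ w ≤ G.card * (Q * (n * z))) ∧
      (∏ g ∈ G, ∑ y ∈ B g, z ^ t y) / 2
        ≤ ((S.filter fun f => (T f : ℝ) ≤ w + Δ).card : ℝ) * z ^ (w - Δ) := by
  have hone : ∀ z : ℝ, 0 ≤ z → ∀ g ∈ G, 1 ≤ (weightPoly (B g) t).eval z := fun z hz g hg =>
    one_le_eval_weightPoly hz (h0 g hg)
  have hW : ∀ z : ℝ, 0 ≤ z → 1 ≤ (weightPoly S T).eval z := by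
    intro z hz
    rw [hprod, eval_prod]
    exact Finset.one_le_prod (hone z hz)
  obtain ⟨z, hz, hmean⟩ := exists_tiltMean_eq hW hw
  have hne : ∀ g ∈ G, (weightPoly (B g) t).eval z ≠ 0 := fun g hg =>
    (zero_lt_one.trans_le (hone z hz.1.le g hg)).ne'
  refine ⟨z, hz, ?_, ?_⟩
  · refine hmean.imp (·.1) fun h => ?_
    rw [← h, hprod, tiltMean_prod hne]
    refine (Finset.sum_le_card_nsmul G _ (Q * (n * z)) fun g hg =>
      tiltMean_weightPoly_le hz.1.le hz.2 (h0 g hg) (hn g hg) (hQ g hg)).trans_eq ?_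
    rw [nsmul_eq_mul]
  · have hV : tiltVar (weightPoly S T) z ≤ G.card * (n : ℝ) ^ 2 := by
      rw [hprod, tiltVar_prod hne, ← nsmul_eq_mul]
      exact Finset.sum_le_card_nsmul G _ _ fun g hg =>
        tiltVar_weightPoly_le hz.1.le (h0 g hg) (hn g hg)
    have hhalf := half_eval_le_sum_near_tiltMean (S := S) (T := T) hz.1.le
      (zero_lt_one.trans_le (hW z hz.1.le)) hΔ (by linarith)
    have hev : (weightPoly S T).eval z = ∏ g ∈ G, ∑ y ∈ B g, z ^ t y := by
      simp [hprod, eval_prod, eval_weightPoly]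
    rw [hev] at hhalf
    refine hhalf.trans ((Finset.sum_le_card_nsmul _ _ (z ^ (w - Δ)) fun f hf => ?_).trans ?_)
    · have hf := (abs_le.1 (Finset.mem_filter.1 hf).2).1
      rcases hmean with ⟨rfl, -⟩ | h
      · simp
      · rw [← Real.rpow_natCast]
        exact Real.rpow_le_rpow_of_exponent_ge hz.1 hz.2 (by linarith)
    · rw [nsmul_eq_mul]
      refine mul_le_mul_of_nonneg_right ?_ (Real.rpow_nonneg hz.1.le _)
      refine Nat.cast_le.2 (Finset.card_le_card fun f hf => ?_)
      obtain ⟨hfS, hf⟩ := Finset.mem_filter.1 hf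
      refine Finset.mem_filter.2 ⟨hfS, ?_⟩
      have := (abs_le.1 hf).2
      rcases hmean with ⟨-, h⟩ | h <;> linarith

end Tilting

/-! ### Codes cut out by overlapping parity checks -/

section ParityChecks

variable {K : Type*} [Field K] {ι : Type*} [Fintype ι] [DecidableEq ι]

/-- The coordinates of `G` lying in no other member of `𝒢`. -/
def privatePart (𝒢 : Finset (Finset ι)) (G : Finset ι) : Finset ι :=
  G.filter fun t => ∀ G' ∈ 𝒢, t ∈ G' → G' = G

/-- `A` is cut out by parity checks `a G` supported on the sets `G ∈ 𝒢`, which cover all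
coordinates, have size at most `n`, and each contain a private coordinate. -/
structure IsParityCode (n : ℕ) (𝒢 : Finset (Finset ι)) (a : Finset ι → ι → K)
    (A : Set (ι → K)) : Prop where
  coeff_ne_zero : ∀ G ∈ 𝒢, ∀ t ∈ G, a G t ≠ 0
  card_le : ∀ G ∈ 𝒢, G.card ≤ n
  cover : ∀ t, ∃ G ∈ 𝒢, t ∈ G
  private_nonempty : ∀ G ∈ 𝒢, (privatePart 𝒢 G).Nonempty
  mem_iff : ∀ x, x ∈ A ↔ ∀ G ∈ 𝒢, ∑ t ∈ G, a G t * x t = 0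

lemma mem_privatePart {𝒢 : Finset (Finset ι)} {G : Finset ι} {t : ι} :
    t ∈ privatePart 𝒢 G ↔ t ∈ G ∧ ∀ G' ∈ 𝒢, t ∈ G' → G' = G := by
  simp [privatePart]

lemma sum_card_eq_sum_card_filter (𝒢 : Finset (Finset ι)) (f : Finset ι → Finset ι) :
    ∑ G ∈ 𝒢, (f G).card = ∑ t : ι, (𝒢.filter fun G => t ∈ f G).card := by
  simp only [Finset.card_filter]
  rw [Finset.sum_comm]
  simp

lemma sum_card_privatePart_le (𝒢 : Finset (Finset ι)) :
    ∑ G ∈ 𝒢, (privatePart 𝒢 G).card ≤ Fintype.card ι := by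
  rw [sum_card_eq_sum_card_filter, ← Finset.card_univ, Finset.card_eq_sum_ones]
  refine Finset.sum_le_sum fun t _ => Finset.card_le_one.2 fun G hG G' hG' => ?_
  rw [Finset.mem_filter, mem_privatePart] at hG hG'
  exact hG'.2.2 G hG.1 hG.2.1

lemma weightPoly_pi [DecidableEq K] (𝒢 : Finset (Finset ι)) (B : Finset ι → Finset (ι → K)) :
    weightPoly (𝒢.pi B) (fun p => ∑ G ∈ 𝒢.attach, hammingNorm (p G.1 G.2))
      = ∏ G ∈ 𝒢, weightPoly (B G) hammingNorm := by
  simp only [weightPoly, Finset.prod_sum, Finset.prod_pow_eq_pow_sum]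

namespace IsParityCode

variable {n : ℕ} {𝒢 : Finset (Finset ι)} {a : Finset ι → ι → K} {A : Set (ι → K)}

lemma zero_mem (h : IsParityCode n 𝒢 a A) : 0 ∈ A := (h.mem_iff 0).2 (by simp)

lemma two_mul_card_le (h : IsParityCode n 𝒢 a A) :
    2 * Fintype.card ι ≤ ∑ G ∈ 𝒢, (privatePart 𝒢 G).card + n * 𝒢.card := by
  have h1 : ∑ G ∈ 𝒢, G.card ≤ n * 𝒢.card := by
    rw [mul_comm, ← smul_eq_mul]; exact Finset.sum_le_card_nsmul _ _ _ h.card_le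
  refine le_trans ?_ (Nat.add_le_add_left h1 _)
  rw [sum_card_eq_sum_card_filter, sum_card_eq_sum_card_filter 𝒢 fun G => G,
    ← Finset.sum_add_distrib, mul_comm, ← smul_eq_mul, ← Finset.card_univ]
  refine Finset.card_nsmul_le_sum _ _ _ fun t _ => ?_
  obtain ⟨G, hG, htG⟩ := h.cover t
  have hdeg : 0 < (𝒢.filter fun G => t ∈ G).card :=
    Finset.card_pos.2 ⟨G, Finset.mem_filter.2 ⟨hG, htG⟩⟩
  by_cases hp : t ∈ privatePart 𝒢 G
  · have : 0 < (𝒢.filter fun G => t ∈ privatePart 𝒢 G).card :=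
      Finset.card_pos.2 ⟨G, Finset.mem_filter.2 ⟨hG, hp⟩⟩
    omega
  · have : ∃ G' ∈ 𝒢, t ∈ G' ∧ G' ≠ G := by
      by_contra! hcon
      exact hp (mem_privatePart.2 ⟨htG, hcon⟩)
    obtain ⟨G', hG', htG', hne⟩ := this
    have : 1 < (𝒢.filter fun G => t ∈ G).card := Finset.one_lt_card.2
      ⟨G, Finset.mem_filter.2 ⟨hG, htG⟩, G', Finset.mem_filter.2 ⟨hG', htG'⟩, hne.symm⟩
    omega

lemma card_privatePart_mem_Icc (h : IsParityCode n 𝒢 a A) {G : Finset ι} (hG : G ∈ 𝒢) :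
    (privatePart 𝒢 G).card ∈ Finset.Icc 1 n :=
  Finset.mem_Icc.2 ⟨(h.private_nonempty G hG).card_pos,
    (Finset.card_le_card (Finset.filter_subset _ G)).trans (h.card_le G hG)⟩

lemma card_groups_le (h : IsParityCode n 𝒢 a A) : 𝒢.card ≤ Fintype.card ι := by
  refine le_trans ?_ (sum_card_privatePart_le 𝒢)
  rw [Finset.card_eq_sum_ones]
  exact Finset.sum_le_sum fun G hG => (h.private_nonempty G hG).card_pos

variable [Fintype K]

/-- Private coordinates are determined by the others. -/
lemma ncard_le {q : ℕ} (hq : Fintype.card K = q) (h : IsParityCode n 𝒢 a A) :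
    A.ncard ≤ q ^ (Fintype.card ι - 𝒢.card) := by
  choose r hr using h.private_nonempty
  set I : Finset ι := 𝒢.attach.image fun G => r G.1 G.2 with hI
  have hIcard : I.card = 𝒢.card := by
    rw [hI, Finset.card_image_of_injective, Finset.card_attach]
    intro G G' hGG'
    have h1 := mem_privatePart.1 (hr G.1 G.2)
    have h2 := mem_privatePart.1 (hr G'.1 G'.2)
    exact Subtype.ext (h2.2 G.1 G.2 (by simpa only [← hGG'] using h1.1))
  have hinj : Set.InjOn (fun (x : ι → K) (t : ↥(Iᶜ)) => x t) A := by
    intro x hx y hy hxy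
    have hout : ∀ t, t ∉ I → x t = y t := fun t ht =>
      congr_fun hxy ⟨t, Finset.mem_compl.2 ht⟩
    funext t
    by_cases ht : t ∈ I
    · obtain ⟨⟨G, hG⟩, -, rfl⟩ := Finset.mem_image.1 ht
      have hrG := (mem_privatePart.1 (hr G hG)).1
      have hx' := (h.mem_iff x).1 hx G hG
      have hy' := (h.mem_iff y).1 hy G hG
      rw [← Finset.add_sum_erase _ _ hrG] at hx' hy'
      have hrest : ∑ u ∈ G.erase (r G hG), a G u * x u = ∑ u ∈ G.erase (r G hG), a G u * y u := by
        refine Finset.sum_congr rfl fun u hu => ?_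
        obtain ⟨hne, huG⟩ := Finset.mem_erase.1 hu
        rw [hout u fun huI => ?_]
        obtain ⟨⟨G', hG'⟩, -, rfl⟩ := Finset.mem_image.1 huI
        obtain rfl := (mem_privatePart.1 (hr G' hG')).2 G hG huG
        exact hne rfl
      rw [hrest] at hx'
      exact mul_left_cancel₀ (h.coeff_ne_zero G hG _ hrG) (add_right_cancel (hx'.trans hy'.symm))
    · exact hout t ht
  have := Set.ncard_le_ncard_of_injOn (t := Set.univ) _ (fun _ _ => Set.mem_univ _) hinj
  rw [Set.ncard_univ, Nat.card_eq_fintype_card, Fintype.card_fun, hq, Fintype.card_coe,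
    Finset.card_compl, hIcard] at this
  exact this

variable [DecidableEq K]

lemma sum_private_eq {G : Finset ι} {x : ι → K} (b : ι → K) {P : Finset ι} (hP : P ⊆ G)
    (hx : x ∈ parityWords b P 0) : ∑ t ∈ G, b t * x t = 0 := by
  obtain ⟨h1, h2⟩ := mem_parityWords.1 hx
  rw [← h2]
  exact (Finset.sum_subset hP fun t _ ht => by rw [h1 t ht, mul_zero]).symm

/-- Families of private words glue to codewords without increasing the weight. -/
lemma card_filter_pi_le (h : IsParityCode n 𝒢 a A) (ρ : ℝ) :
    ((𝒢.pi fun G => parityWords (a G) (privatePart 𝒢 G) 0).filter fun p =>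
        ((∑ G ∈ 𝒢.attach, hammingNorm (p G.1 G.2) : ℕ) : ℝ) ≤ ρ).card
      ≤ {c ∈ A | (hammingNorm c : ℝ) ≤ ρ}.ncard := by
  rw [← Set.ncard_coe_finset]
  refine Set.ncard_le_ncard_of_injOn
    (fun p : (∀ G ∈ 𝒢, ι → K) => ∑ G ∈ 𝒢.attach, p G.1 G.2) ?_ ?_ (Set.toFinite _)
  · intro p hp
    obtain ⟨hp, hpρ⟩ := Finset.mem_filter.1 (Finset.mem_coe.1 hp)
    have hp' := Finset.mem_pi.1 hp
    refine ⟨(h.mem_iff _).2 fun G hG => ?_, ?_⟩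
    · simp only [Finset.sum_apply, Finset.mul_sum]
      rw [Finset.sum_comm]
      refine Finset.sum_eq_zero fun G' _ => ?_
      by_cases hGG' : G'.1 = G
      · obtain ⟨G', hG'⟩ := G'
        obtain rfl : G' = G := hGG'
        exact sum_private_eq (a G') (Finset.filter_subset _ _) (hp' G' hG')
      · refine Finset.sum_eq_zero fun t ht => ?_
        rw [(mem_parityWords.1 (hp' G'.1 G'.2)).1 t fun htp => ?_, mul_zero]
        exact hGG' ((mem_privatePart.1 htp).2 G hG ht).symm
    · refine le_trans (Nat.cast_le.2 ?_) hpρ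
      refine Finset.le_sum_of_subadditive (hammingNorm : (ι → K) → ℕ) hammingNorm_zero.le ?_ _ _
      intro x y
      simpa [hammingDist_eq_hammingNorm] using hammingDist_triangle (-x) 0 y
  · intro p hp p' hp' heq
    have hp := Finset.mem_pi.1 (Finset.mem_filter.1 (Finset.mem_coe.1 hp)).1
    have hp' := Finset.mem_pi.1 (Finset.mem_filter.1 (Finset.mem_coe.1 hp')).1
    have key : ∀ s : (∀ G ∈ 𝒢, ι → K),
        (∀ G (hG : G ∈ 𝒢), s G hG ∈ parityWords (a G) (privatePart 𝒢 G) 0) →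
        ∀ G (hG : G ∈ 𝒢), ∀ t ∈ privatePart 𝒢 G,
          (∑ G' ∈ 𝒢.attach, s G'.1 G'.2) t = s G hG t := by
      intro s hs G hG t ht
      rw [Finset.sum_apply, Finset.sum_eq_single (⟨G, hG⟩ : {x // x ∈ 𝒢})]
      · intro G' _ hne
        refine (mem_parityWords.1 (hs G'.1 G'.2)).1 t fun htp => hne (Subtype.ext ?_)
        exact (mem_privatePart.1 ht).2 G'.1 G'.2 (mem_privatePart.1 htp).1
      · exact fun hn => absurd (Finset.mem_attach _ _) hn
    funext G hG t
    by_cases ht : t ∈ privatePart 𝒢 G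
    · rw [← key p hp G hG t ht, ← key p' hp' G hG t ht]
      exact congr_fun heq t
    · rw [(mem_parityWords.1 (hp G hG)).1 t ht, (mem_parityWords.1 (hp' G hG)).1 t ht]

lemma enum_private {q : ℕ} (hq : Fintype.card K = q) (h : IsParityCode n 𝒢 a A) {G : Finset ι}
    (hG : G ∈ 𝒢) (z : ℝ) :
    ∑ x ∈ parityWords (a G) (privatePart 𝒢 G) 0, z ^ hammingNorm x
      = parityEnum q (privatePart 𝒢 G).card z :=
  sum_parityWords_zero hq _ _
    (fun t ht => h.coeff_ne_zero G hG t (Finset.filter_subset _ G ht)) z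

lemma card_private_le {q : ℕ} (hq : Fintype.card K = q) (hq2 : 2 ≤ q) (h : IsParityCode n 𝒢 a A)
    {G : Finset ι} (hG : G ∈ 𝒢) : (parityWords (a G) (privatePart 𝒢 G) 0).card ≤ q ^ n :=
  (card_parityWords_le hq _ _ _).trans
    (Nat.pow_le_pow_right (by omega) (Finset.mem_Icc.1 (h.card_privatePart_mem_Icc hG)).2)

lemma ncard_lowWeight_pos (h : IsParityCode n 𝒢 a A) {ρ : ℝ} (hρ : 0 ≤ ρ) :
    0 < {c ∈ A | (hammingNorm c : ℝ) ≤ ρ}.ncard :=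
  (Set.ncard_pos (Set.toFinite _)).2 ⟨0, h.zero_mem, by simpa using hρ⟩

lemma rate_le {q : ℕ} (hq : Fintype.card K = q) (hq2 : 2 ≤ q) (h : IsParityCode n 𝒢 a A)
    {ω ρ η z : ℝ} (hω : 0 ≤ ω) (hρ : 0 ≤ ρ) (hι : 0 < Fintype.card ι)
    (hz : z ∈ Set.Ioc (0 : ℝ) 1)
    (hlow : ∏ G ∈ 𝒢, parityEnum q (privatePart 𝒢 G).card z
      ≤ ({c ∈ A | (hammingNorm c : ℝ) ≤ ρ}.ncard : ℝ) * (q : ℝ) ^ (η * Fintype.card ι)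
        * z ^ (ω * Fintype.card ι)) :
    Real.logb q ((A.ncard : ℝ) / ({c ∈ A | (hammingNorm c : ℝ) ≤ ρ}.ncard : ℝ)) / Fintype.card ι
      ≤ Rhat0 q n ω + η := by
  have hq' : (1 : ℝ) < q := by exact_mod_cast hq2
  have hN : (0 : ℝ) < Fintype.card ι := by exact_mod_cast hι
  have hB : (0 : ℝ) < ({c ∈ A | (hammingNorm c : ℝ) ≤ ρ}.ncard : ℝ) := by
    exact_mod_cast h.ncard_lowWeight_pos hρ
  have hApos : (0 : ℝ) < A.ncard := by
    exact_mod_cast (Set.ncard_pos (Set.toFinite _)).2 ⟨0, h.zero_mem⟩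
  have hA : Real.logb q A.ncard ≤ Fintype.card ι - 𝒢.card := by
    have h1 : (A.ncard : ℝ) ≤ (q : ℝ) ^ (Fintype.card ι - 𝒢.card) := by
      exact_mod_cast h.ncard_le hq
    have h2 := Real.logb_le_logb_of_le hq' hApos h1
    rwa [Real.logb_pow, Real.logb_self_eq_one hq', mul_one, Nat.cast_sub h.card_groups_le] at h2
  have hE : ∀ G ∈ 𝒢, 0 < parityEnum q (privatePart 𝒢 G).card z := fun G _ =>
    div_pos (by linarith [le_one_add_pow_add q hq'.le (privatePart 𝒢 G).card hz]) (by linarith)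
  have hL := Real.logb_le_logb_of_le hq' (Finset.prod_pos hE) hlow
  have hzpos := Real.rpow_pos_of_pos hz.1 (ω * Fintype.card ι)
  have hqpos := Real.rpow_pos_of_pos (by linarith : (0 : ℝ) < q) (η * Fintype.card ι)
  rw [Real.logb_mul (by positivity) hzpos.ne', Real.logb_mul hB.ne' hqpos.ne',
    Real.logb_rpow (by linarith) hq'.ne', Real.logb_rpow_eq_mul_logb_of_pos hz.1,
    Real.logb_prod _ _ fun G hG => (hE G hG).ne'] at hL
  have hR := rate_le_Rhat0 hq2 (n := n) hω 𝒢 (fun G => (privatePart 𝒢 G).card)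
    (fun G hG => h.card_privatePart_mem_Icc hG) hN
    (by exact_mod_cast sum_card_privatePart_le 𝒢)
    (by
      have := h.two_mul_card_le
      rw [sub_le_iff_le_add']
      exact_mod_cast this) hz
  rw [div_le_iff₀ hN, Real.logb_div hApos.ne' hB.ne']
  linarith

end IsParityCode

end ParityChecks

section LowWeight

variable {K : Type*} [Field K] [Fintype K] [DecidableEq K] {ι : Type*} [Fintype ι] [DecidableEq ι]
  {n : ℕ} {𝒢 : Finset (Finset ι)} {a : Finset ι → ι → K} {A : Set (ι → K)}

namespace IsParityCode

lemma exists_enum_le_of_zero {q : ℕ} (hq : Fintype.card K = q) (hq2 : 2 ≤ q)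
    (h : IsParityCode n 𝒢 a A) {η ρ : ℝ} (hη : 0 < η) (hρ : 0 ≤ ρ) :
    ∃ z ∈ Set.Ioc (0 : ℝ) 1, ∏ G ∈ 𝒢, parityEnum q (privatePart 𝒢 G).card z
      ≤ ({c ∈ A | (hammingNorm c : ℝ) ≤ ρ}.ncard : ℝ) * (q : ℝ) ^ (η * Fintype.card ι)
        * z ^ ((0 : ℝ) * Fintype.card ι) := by
  have hq' : (1 : ℝ) < q := by exact_mod_cast hq2
  have hη1 : (1 : ℝ) < (q : ℝ) ^ η := Real.one_lt_rpow hq' hη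
  have hQ : (0 : ℝ) < (q : ℝ) ^ n := by positivity
  set z : ℝ := min 1 (((q : ℝ) ^ η - 1) / (q : ℝ) ^ n) with hzdef
  have hz0 : 0 < z := lt_min one_pos (div_pos (by linarith) hQ)
  have hz1 : z ≤ 1 := min_le_left _ _
  have hzQ : (q : ℝ) ^ n * z ≤ (q : ℝ) ^ η - 1 := by
    have : z ≤ ((q : ℝ) ^ η - 1) / (q : ℝ) ^ n := min_le_right _ _
    rwa [le_div_iff₀ hQ, mul_comm] at this
  have hblock : ∀ G ∈ 𝒢, parityEnum q (privatePart 𝒢 G).card z ≤ (q : ℝ) ^ η := by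
    intro G hG
    rw [← h.enum_private hq hG, ← Finset.add_sum_erase _ _ (zero_mem_parityWords (a G) _),
      hammingNorm_zero, pow_zero]
    have hrest : ∑ x ∈ (parityWords (a G) (privatePart 𝒢 G) 0).erase 0, z ^ hammingNorm x
        ≤ (parityWords (a G) (privatePart 𝒢 G) 0).card * z := by
      refine (Finset.sum_le_card_nsmul _ _ z fun x hx => ?_).trans ?_
      · exact pow_le_of_le_one hz0.le hz1 (hammingNorm_ne_zero_iff.2 (Finset.ne_of_mem_erase hx))
      · rw [nsmul_eq_mul]
        gcongr
        exact Finset.erase_subset _ _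
    have hcard : ((parityWords (a G) (privatePart 𝒢 G) 0).card : ℝ) ≤ (q : ℝ) ^ n := by
      exact_mod_cast h.card_private_le hq hq2 hG
    have := mul_le_mul_of_nonneg_right hcard hz0.le
    linarith
  refine ⟨z, ⟨hz0, hz1⟩, ?_⟩
  have hE : ∀ G ∈ 𝒢, 0 ≤ parityEnum q (privatePart 𝒢 G).card z := fun G hG => by
    rw [← h.enum_private hq hG]
    exact Finset.sum_nonneg fun x _ => by positivity
  have hB : (1 : ℝ) ≤ ({c ∈ A | (hammingNorm c : ℝ) ≤ ρ}.ncard : ℝ) := by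
    exact_mod_cast h.ncard_lowWeight_pos hρ
  rw [zero_mul, Real.rpow_zero, mul_one, Real.rpow_mul (by linarith), Real.rpow_natCast]
  calc ∏ G ∈ 𝒢, parityEnum q (privatePart 𝒢 G).card z ≤ ∏ _G ∈ 𝒢, (q : ℝ) ^ η :=
        Finset.prod_le_prod hE hblock
    _ = ((q : ℝ) ^ η) ^ 𝒢.card := by rw [Finset.prod_const]
    _ ≤ ((q : ℝ) ^ η) ^ Fintype.card ι := pow_le_pow_right₀ hη1.le h.card_groups_le
    _ ≤ _ := le_mul_of_one_le_left (by positivity) hB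

lemma exists_enum_le_of_pos {q : ℕ} (hq : Fintype.card K = q) (hq2 : 2 ≤ q) (hn : 1 ≤ n)
    (h : IsParityCode n 𝒢 a A) {ω δ η ρ : ℝ} (hι : 0 < Fintype.card ι) (hω : 0 < ω) (hδ : 0 < δ)
    (hδω : 4 * δ ≤ ω)
    (hlog : 3 * δ * -Real.logb q (min 1 (ω / (2 * ((q : ℝ) ^ n * n)))) ≤ η / 2)
    (hNδ : 2 * (n : ℝ) ^ 2 ≤ δ ^ 2 * Fintype.card ι) (hNη : 2 ≤ η * Fintype.card ι)
    (hρ : (ω - δ) * Fintype.card ι ≤ ρ) :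
    ∃ z ∈ Set.Ioc (0 : ℝ) 1, ∏ G ∈ 𝒢, parityEnum q (privatePart 𝒢 G).card z
      ≤ ({c ∈ A | (hammingNorm c : ℝ) ≤ ρ}.ncard : ℝ) * (q : ℝ) ^ (η * Fintype.card ι)
        * z ^ (ω * Fintype.card ι) := by
  have hq' : (1 : ℝ) < q := by exact_mod_cast hq2
  have hq0 : (0 : ℝ) < q := by linarith
  set N : ℝ := (Fintype.card ι : ℝ) with hNdef
  have hN : 0 < N := Nat.cast_pos.2 hι
  have hmN : (𝒢.card : ℝ) ≤ N := Nat.cast_le.2 h.card_groups_le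
  have hn' : (1 : ℝ) ≤ n := by exact_mod_cast hn
  set ζ : ℝ := min 1 (ω / (2 * ((q : ℝ) ^ n * n))) with hζdef
  have hζ0 : 0 < ζ := lt_min one_pos (by positivity)
  obtain ⟨z, hz, hzlow, hhalf⟩ := exists_half_enum_le_card 𝒢
    (fun G => parityWords (a G) (privatePart 𝒢 G) 0) hammingNorm _ _ (weightPoly_pi 𝒢 _)
    (n := n) (Q := q ^ n) (w := (ω - 2 * δ) * N) (Δ := δ * N)
    (fun G _ => ⟨0, zero_mem_parityWords _ _, hammingNorm_zero⟩)
    (fun G hG x hx => (hammingNorm_le_card_of_support (mem_parityWords.1 hx).1).trans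
      (Finset.mem_Icc.1 (h.card_privatePart_mem_Icc hG)).2)
    (fun G hG => h.card_private_le hq hq2 hG)
    (mul_pos (by linarith) hN) (mul_pos hδ hN) (by
      have : (𝒢.card : ℝ) * (n : ℝ) ^ 2 ≤ N * (n : ℝ) ^ 2 := by gcongr
      nlinarith [mul_le_mul_of_nonneg_left hNδ hN.le])
  refine ⟨z, hz, ?_⟩
  have hζz : ζ ≤ z := by
    rcases hzlow with rfl | hzlow
    · exact min_le_left _ _
    · refine (min_le_right _ _).trans ?_
      rw [div_le_iff₀ (by positivity)]
      push_cast at hzlow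
      have h1 : (ω - 2 * δ) * N ≤ N * ((q : ℝ) ^ n * (n * z)) := hzlow.trans (by
        have := hz.1.le
        gcongr)
      have h2 : ω - 2 * δ ≤ (q : ℝ) ^ n * (n * z) :=
        le_of_mul_le_mul_left (by linarith) hN
      linarith
  have hcard : (((𝒢.pi fun G => parityWords (a G) (privatePart 𝒢 G) 0).filter fun p =>
        ((∑ G ∈ 𝒢.attach, hammingNorm (p G.1 G.2) : ℕ) : ℝ)
          ≤ (ω - 2 * δ) * N + δ * N).card : ℝ)
      ≤ ({c ∈ A | (hammingNorm c : ℝ) ≤ ρ}.ncard : ℝ) := by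
    refine Nat.cast_le.2 ((h.card_filter_pi_le _).trans (Set.ncard_le_ncard ?_ (Set.toFinite _)))
    exact fun c hc => ⟨hc.1, hc.2.trans (by linarith)⟩
  rw [Finset.prod_congr rfl fun G hG => h.enum_private hq hG z] at hhalf
  have hzpow : z ^ ((ω - 2 * δ) * N - δ * N) ≤ z ^ (ω * N) * (q : ℝ) ^ (η * N / 2) := by
    have h1 : (ω - 2 * δ) * N - δ * N = ω * N + -(3 * δ * N) := by ring
    rw [h1, Real.rpow_add hz.1]
    refine mul_le_mul_of_nonneg_left ?_ (Real.rpow_nonneg hz.1.le _)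
    calc z ^ (-(3 * δ * N)) ≤ ζ ^ (-(3 * δ * N)) :=
          Real.rpow_le_rpow_of_nonpos hζ0 hζz (by
            have : 0 < 3 * δ * N := by positivity
            linarith)
      _ = (q : ℝ) ^ (Real.logb q ζ * -(3 * δ * N)) := by
          rw [Real.rpow_mul hq0.le, Real.rpow_logb hq0 hq'.ne' hζ0]
      _ ≤ (q : ℝ) ^ (η * N / 2) := by
          refine Real.rpow_le_rpow_of_exponent_le hq'.le ?_
          nlinarith [mul_le_mul_of_nonneg_right hlog hN.le]
  have htwo : (2 : ℝ) ≤ (q : ℝ) ^ (η * N / 2) := by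
    calc (2 : ℝ) ≤ (q : ℝ) ^ (1 : ℝ) := by rw [Real.rpow_one]; exact_mod_cast hq2
      _ ≤ _ := Real.rpow_le_rpow_of_exponent_le hq'.le (by linarith)
  have hsq : (q : ℝ) ^ (η * N) = (q : ℝ) ^ (η * N / 2) * (q : ℝ) ^ (η * N / 2) := by
    rw [← Real.rpow_add hq0]; ring_nf
  have hzpos : 0 ≤ z ^ (ω * N) := Real.rpow_nonneg hz.1.le _
  have hchain := hhalf.trans (mul_le_mul hcard hzpow (Real.rpow_nonneg hz.1.le _) (by positivity))
  set B : ℝ := ({c ∈ A | (hammingNorm c : ℝ) ≤ ρ}.ncard : ℝ) with hB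
  set r : ℝ := (q : ℝ) ^ (η * N / 2) with hr
  calc ∏ G ∈ 𝒢, parityEnum q (privatePart 𝒢 G).card z ≤ 2 * (B * (z ^ (ω * N) * r)) := by linarith
    _ ≤ r * (B * (z ^ (ω * N) * r)) := by gcongr
    _ = B * (q : ℝ) ^ (η * N) * z ^ (ω * N) := by rw [hsq]; ring

end IsParityCode

end LowWeight

/-! ### Parity checks from constituent codes -/

lemma exists_parity_of_minDist_two {K : Type} [Field K] [DecidableEq K] {ι : Type} [Fintype ι]
    (C : Submodule K (ι → K)) (hdim : Module.finrank K C = Fintype.card ι - 1)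
    (hd : minDist (C : Set (ι → K)) = 2) :
    ∃ b : ι → K, (∀ t, b t ≠ 0) ∧ ∀ x, x ∈ C ↔ ∑ t, b t * x t = 0 := by
  classical
  have hne : Nonempty ι := by
    by_contra hemp
    rw [not_nonempty_iff] at hemp
    have h0 : {d : ℕ | ∃ c ∈ (C : Set (ι → K)), ∃ c' ∈ (C : Set (ι → K)),
        c ≠ c' ∧ hammingDist c c' = d} = ∅ := by
      ext d
      simp only [Set.mem_ofPred_eq, Set.mem_empty_iff_false, iff_false]
      rintro ⟨c, -, c', -, hcc, -⟩
      exact hcc (Subsingleton.elim c c')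
    rw [minDist, h0, Nat.sInf_empty] at hd
    omega
  have hpos : 0 < Fintype.card ι := Fintype.card_pos
  have hlt : C < ⊤ := by
    refine lt_top_iff_ne_top.2 fun htop => ?_
    rw [htop, finrank_top, Module.finrank_fintype_fun_eq_card] at hdim
    omega
  obtain ⟨f, hf, hCf⟩ := Submodule.exists_le_ker_of_lt_top C hlt
  have hker : C = LinearMap.ker f := by
    refine Submodule.eq_of_le_of_finrank_le hCf ?_
    have hrk := Module.Dual.finrank_ker_add_one_of_ne_zero hf
    rw [Module.finrank_fintype_fun_eq_card] at hrk
    omega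
  have hfsum : ∀ x, f x = ∑ t, f (Pi.single t 1) * x t := by
    intro x
    conv_lhs => rw [← Finset.univ_sum_single x, map_sum]
    refine Finset.sum_congr rfl fun t _ => ?_
    have : (Pi.single t (x t) : ι → K) = x t • Pi.single t 1 := by
      rw [← Pi.single_smul', smul_eq_mul, mul_one]
    rw [this, map_smul, smul_eq_mul, mul_comm]
  refine ⟨fun t => f (Pi.single t 1), fun t ht => ?_, fun x => ?_⟩
  · have hmem : (Pi.single t 1 : ι → K) ∈ C := by rw [hker]; exact ht
    have hle : minDist (C : Set (ι → K)) ≤ 1 := by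
      have hdist : hammingDist (Pi.single t 1 : ι → K) 0 ∈ {d : ℕ | ∃ c ∈ (C : Set (ι → K)),
          ∃ c' ∈ (C : Set (ι → K)), c ≠ c' ∧ hammingDist c c' = d} :=
        ⟨Pi.single t 1, hmem, 0, C.zero_mem, by simp, rfl⟩
      refine (Nat.sInf_le hdist).trans ?_
      rw [hammingDist_zero_right]
      refine (Finset.card_le_card (t := {t}) fun u hu => ?_).trans_eq (Finset.card_singleton t)
      by_contra hut
      exact (Finset.mem_filter.1 hu).2 (Pi.single_eq_of_ne (by simpa using hut) _)
    omega
  · rw [hker, LinearMap.mem_ker, hfsum]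

/-- A code defined by its constituents of dimension `|R_j| - 1` and minimum distance two is cut
out by parity checks, one for each distinct repair group. -/
lemma exists_isParityCode {K : Type} [Field K] [DecidableEq K] {N n : ℕ}
    (R : Fin N → Finset (Fin N)) (hmem : ∀ j, j ∈ R j) (A : Set (Fin N → K))
    (C : ∀ j, Submodule K (↥(R j) → K))
    (hdim : ∀ j, Module.finrank K (C j) = (R j).card - 1)
    (hd2 : ∀ j, minDist (C j : Set (↥(R j) → K)) = 2)
    (hA : A = {x | ∀ j, (fun t : ↥(R j) => x ↑t) ∈ C j})
    (himg : ∀ j, (fun x : Fin N → K => fun t : ↥(R j) => x ↑t) '' A = (C j : Set (↥(R j) → K)))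
    (hcard : ∀ j, (R j).card ≤ n)
    (hpriv : ∀ j, ∃ j' ∈ R j, ∀ j'', R j'' ≠ R j → j' ∉ R j'') :
    ∃ a : Finset (Fin N) → Fin N → K, IsParityCode n (Finset.univ.image R) a A := by
  have hb : ∀ j, ∃ b : Fin N → K, (∀ t ∈ R j, b t ≠ 0) ∧
      ∀ x : Fin N → K, (fun t : ↥(R j) => x ↑t) ∈ C j ↔ ∑ t ∈ R j, b t * x t = 0 := by
    intro j
    obtain ⟨b, hb0, hb⟩ := exists_parity_of_minDist_two (C j)
      (by rw [hdim, Fintype.card_coe]) (hd2 j)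
    refine ⟨fun t => if ht : t ∈ R j then b ⟨t, ht⟩ else 0, fun t ht => ?_, fun x => ?_⟩
    · simpa [ht] using hb0 ⟨t, ht⟩
    · rw [hb, ← Finset.sum_coe_sort (R j)]
      simp
  choose b hb0 hb using hb
  have hG : ∀ G : Finset (Fin N), ∃ a : Fin N → K,
      ∀ j, R j = G → ∃ j₀, R j₀ = G ∧ a = b j₀ := by
    intro G
    by_cases h : ∃ j, R j = G
    · obtain ⟨j, hj⟩ := h
      exact ⟨b j, fun _ _ => ⟨j, hj, rfl⟩⟩
    · exact ⟨0, fun j hj => absurd ⟨j, hj⟩ h⟩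
  choose a ha using hG
  refine ⟨a, ?_, ?_, ?_, ?_, ?_⟩
  · intro G hG t ht
    obtain ⟨j, -, hj⟩ := Finset.mem_image.1 hG
    obtain ⟨j₀, hj₀, haj⟩ := ha G j hj
    rw [haj]
    exact hb0 j₀ t (hj₀ ▸ ht)
  · intro G hG
    obtain ⟨j, -, rfl⟩ := Finset.mem_image.1 hG
    exact hcard j
  · exact fun t => ⟨R t, Finset.mem_image_of_mem R (Finset.mem_univ t), hmem t⟩
  · intro G hG
    obtain ⟨j, -, rfl⟩ := Finset.mem_image.1 hG
    obtain ⟨j', hj', hj''⟩ := hpriv j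
    refine ⟨j', mem_privatePart.2 ⟨hj', fun G' hG' hj'G' => ?_⟩⟩
    obtain ⟨k, -, rfl⟩ := Finset.mem_image.1 hG'
    by_contra hne
    exact hj'' k hne hj'G'
  · intro x
    have hmemA : ∀ y : Fin N → K, y ∈ A ↔ ∀ j, (fun t : ↥(R j) => y ↑t) ∈ C j := fun y => by
      rw [hA]; rfl
    constructor
    · intro hx G hG
      obtain ⟨j, -, hj⟩ := Finset.mem_image.1 hG
      obtain ⟨j₀, rfl, haj⟩ := ha G j hj
      rw [haj]
      exact (hb j₀ x).1 ((hmemA x).1 hx j₀)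
    · intro hx
      refine (hmemA x).2 fun j => ?_
      obtain ⟨j₀, hj₀, haj⟩ := ha (R j) j rfl
      have hxj := hx (R j) (Finset.mem_image_of_mem R (Finset.mem_univ j))
      rw [haj, ← hj₀, ← hb j₀ x] at hxj
      have hxim : (fun t : ↥(R j₀) => x ↑t) ∈ (C j₀ : Set (↥(R j₀) → K)) := hxj
      rw [← himg j₀] at hxim
      obtain ⟨y, hy, hyx⟩ := hxim
      have hxy : (fun t : ↥(R j) => x ↑t) = fun t : ↥(R j) => y ↑t := by
        funext t
        exact (congr_fun hyx ⟨t.1, by rw [hj₀]; exact t.2⟩).symm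
      rw [hxy]
      exact (hmemA y).1 hy j

/-- Proposition (ambient spaces, non-disjoint case): if `A_i ⊆ F^{N_i}` is the linear
code defined by requiring that its restriction to each repair group `R_{i,j}` equals the
linear `[|R_{i,j}|, |R_{i,j}|-1, 2]` code `C_{i,j}`, with the list `(R_{i,j})_j`
satisfying conditions (R1)–(R3), then for nonnegative reals `ω_i` with
`liminf_i ω_i = ω`, `limsup_i (1/N_i)·log_q(|A_i| / |A_i(ω_i)|) ≤ R̂_0(ω,n)`. -/
theorem prop_R0_nondisjoint
    (K : Type) [Field K] [Fintype K] [DecidableEq K]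
    (q : ℕ) (hq : Fintype.card K = q)
    (n : ℕ) (hn : 1 ≤ n)
    (Nl : ℕ → ℕ) (hmono : StrictMono Nl)
    (Rg : ∀ i : ℕ, Fin (Nl i) → Finset (Fin (Nl i)))
    (hmem : ∀ i j, j ∈ Rg i j)
    (A : ∀ i : ℕ, Set (Fin (Nl i) → K))
    (Cc : ∀ (i : ℕ) (j : Fin (Nl i)), Submodule K ((↥(Rg i j)) → K))
    -- each constituent is a linear `[|R_{i,j}|, |R_{i,j}|-1, 2]` code
    (hdim : ∀ i j, Module.finrank K (Cc i j) = (Rg i j).card - 1)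
    (hd2 : ∀ i j, minDist ((Cc i j : Set ((↥(Rg i j)) → K))) = 2)
    -- `A_i` is defined by the constituent codes, and its restriction to each repair
    -- group equals the corresponding constituent code
    (hA : ∀ i, A i = {x | ∀ j : Fin (Nl i), (fun t : ↥(Rg i j) => x ↑t) ∈ Cc i j})
    (himg : ∀ i j, (fun x : Fin (Nl i) → K => fun t : ↥(Rg i j) => x ↑t) '' A i
        = (Cc i j : Set ((↥(Rg i j)) → K)))
    -- (R1): each repair group has size at most `n`
    (hR1 : ∀ i j, (Rg i j).card ≤ n)
    -- (R2): each repair group is minimal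
    (hR2 : ∀ i j, ∀ R' : Finset (Fin (Nl i)), R' ⊂ Rg i j →
      ¬ IsRepairGroupFor (A i) j R')
    -- (R3): each repair group contains an index not covered by any other repair group
    (hR3 : ∀ i j, ∃ j' ∈ Rg i j, ∀ j'' : Fin (Nl i), Rg i j'' ≠ Rg i j → j' ∉ Rg i j'')
    (ωs : ℕ → ℝ) (hωs : ∀ i, 0 ≤ ωs i)
    (ω : ℝ) (hω : liminf ωs atTop = ω) :
    limsup (fun i =>
        Real.logb q (((A i).ncard : ℝ) /
          (({c ∈ A i | (hammingNorm c : ℝ) ≤ ωs i * (Nl i : ℝ)}).ncard : ℝ)) / (Nl i : ℝ))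
      atTop ≤ Rhat0 q n ω := by
  have hq2 : 2 ≤ q := hq ▸ Fintype.one_lt_card
  have hq' : (1 : ℝ) < q := by exact_mod_cast hq2
  have hω0 : 0 ≤ ω := by
    rw [← hω, liminf_eq]
    exact Real.sSup_nonneg' ⟨0, Eventually.of_forall hωs, le_rfl⟩
  have hcode : ∀ i, ∃ a : Finset (Fin (Nl i)) → Fin (Nl i) → K,
      IsParityCode n (Finset.univ.image (Rg i)) a (A i) := fun i =>
    exists_isParityCode (Rg i) (hmem i) (A i) (Cc i) (hdim i) (hd2 i) (hA i) (himg i) (hR1 i)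
      (hR3 i)
  choose a ha using hcode
  have hρ : ∀ i, 0 ≤ ωs i * (Nl i : ℝ) := fun i => mul_nonneg (hωs i) (Nat.cast_nonneg _)
  have hNtop : Tendsto (fun i => (Nl i : ℝ)) atTop atTop :=
    tendsto_natCast_atTop_atTop.comp hmono.tendsto_atTop
  refine le_of_forall_pos_le_add fun η hη => limsup_le_of_le ?_ ?_
  · refine isCoboundedUnder_le_of_le atTop (x := 0) fun i => ?_
    refine div_nonneg (Real.logb_nonneg hq' ?_) (Nat.cast_nonneg _)
    rw [one_le_div (by exact_mod_cast (ha i).ncard_lowWeight_pos (hρ i))]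
    have hsub : {c ∈ A i | (hammingNorm c : ℝ) ≤ ωs i * (Nl i : ℝ)} ⊆ A i := fun c hc => hc.1
    exact_mod_cast Set.ncard_le_ncard hsub (Set.toFinite _)
  have hrate : ∀ i, 0 < (Nl i : ℝ) → (∃ z ∈ Set.Ioc (0 : ℝ) 1,
      ∏ G ∈ Finset.univ.image (Rg i),
          parityEnum q (privatePart (Finset.univ.image (Rg i)) G).card z
        ≤ ({c ∈ A i | (hammingNorm c : ℝ) ≤ ωs i * (Nl i : ℝ)}.ncard : ℝ)
          * (q : ℝ) ^ (η * Fintype.card (Fin (Nl i))) * z ^ (ω * Fintype.card (Fin (Nl i)))) →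
      Real.logb q (((A i).ncard : ℝ) /
          (({c ∈ A i | (hammingNorm c : ℝ) ≤ ωs i * (Nl i : ℝ)}).ncard : ℝ)) / (Nl i : ℝ)
        ≤ Rhat0 q n ω + η := by
    rintro i hi ⟨z, hz, hlow⟩
    have h := (ha i).rate_le hq hq2 hω0 (hρ i)
      (by rw [Fintype.card_fin]; exact_mod_cast hi) hz hlow
    rwa [Fintype.card_fin] at h
  rcases hω0.eq_or_lt with rfl | hωpos
  · filter_upwards [hNtop.eventually_gt_atTop 0] with i hi
    exact hrate i hi ((ha i).exists_enum_le_of_zero hq hq2 hη (hρ i))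
  set L : ℝ := -Real.logb q (min 1 (ω / (2 * ((q : ℝ) ^ n * n)))) with hL
  have hn' : (1 : ℝ) ≤ n := by exact_mod_cast hn
  have hL0 : 0 ≤ L := neg_nonneg.2
    (Real.logb_nonpos hq' (le_min zero_le_one (by positivity)) (min_le_left _ _))
  set δ : ℝ := min (ω / 4) (η / (6 * (L + 1))) with hδdef
  have hδ : 0 < δ := lt_min (by positivity) (by positivity)
  have hδω : 4 * δ ≤ ω := by
    have : δ ≤ ω / 4 := min_le_left _ _
    linarith
  have hδL : 3 * δ * L ≤ η / 2 := by
    have h1 : δ ≤ η / (6 * (L + 1)) := min_le_right _ _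
    rw [le_div_iff₀ (by positivity)] at h1
    nlinarith
  have hev : ∀ᶠ i in atTop, ω - δ < ωs i :=
    eventually_lt_of_lt_liminf (by rw [hω]; linarith)
      (isBoundedUnder_of ⟨0, hωs⟩)
  filter_upwards [hev, hNtop.eventually_gt_atTop 0,
    hNtop.eventually_ge_atTop (2 * (n : ℝ) ^ 2 / δ ^ 2), hNtop.eventually_ge_atTop (2 / η)]
    with i hi hNi hNδ hNη
  refine hrate i hNi ((ha i).exists_enum_le_of_pos hq hq2 hn
    (by rw [Fintype.card_fin]; exact_mod_cast hNi) hωpos hδ hδω hδL ?_ ?_ ?_)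
  · rw [div_le_iff₀ (by positivity)] at hNδ
    rw [Fintype.card_fin]
    linarith
  · rw [div_le_iff₀ hη] at hNη
    rw [Fintype.card_fin]
    linarith
  · rw [Fintype.card_fin]
    gcongr
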